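/- arXiv:1704.04665 — 9 statements merged into one kernel-verified Lean document; each statement's English description precedes it below -/
import Mathlib

section
/- Let A be a unital C*-algebra and let v ∈ A be a partial isometry (v v* v = v) such that (1 - v v*) a (1 - v* v) = 0 for every a ∈ A. Then v is an extreme point of the closed unit ball of A. -/
/-- In a C*-algebra, `star x * x ≤ 1` for `x` in the closed unit ball. -/
theorem CStarAlgebra.star_mul_self_le_one_of_norm_le_one {A : Type*} [CStarAlgebra A]
    [PartialOrder A] [StarOrderedRing A] {x : A} (hx : ‖x‖ ≤ 1) : star x * x ≤ 1 := by
  refine (CStarAlgebra.norm_le_one_iff_of_nonneg (star x * x) (star_mul_self_nonneg x)).1 ?_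
  rw [CStarRing.norm_star_mul_self]
  exact mul_le_one₀ hx (norm_nonneg x) hx

/-- If a partial isometry `v` is a proper convex combination of `x` and `y` in the closed unit
ball, then `x - y` vanishes on the initial projection of `v`. -/
theorem sub_mul_star_eq_zero_of_partialIsometry_eq_convexComb {A : Type*} [CStarAlgebra A]
    {v x y : A} (hv : v * star v * v = v) (hx : ‖x‖ ≤ 1) (hy : ‖y‖ ≤ 1) {a b : ℝ}
    (ha : 0 < a) (hb : 0 < b) (hab : a + b = 1) (h : a • x + b • y = v) :
    (x - y) * star v = 0 := by
  let _ : PartialOrder A := CStarAlgebra.spectralOrder A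
  have : StarOrderedRing A := CStarAlgebra.spectralOrderedRing A
  have parallelogram : (a * b) • (star (x - y) * (x - y)) =
      a • (star x * x) + b • (star y * y) - star v * v := by
    obtain rfl : b = 1 - a := by linarith
    rw [← h]
    simp only [star_sub, star_add, star_smul, star_trivial, sub_mul, mul_sub, add_mul, mul_add,
      smul_mul_assoc, mul_smul_comm]
    module
  have hle : (a * b) • (star (x - y) * (x - y)) ≤ 1 - star v * v := by
    rw [parallelogram]
    gcongr
    calc a • (star x * x) + b • (star y * y) ≤ a • (1 : A) + b • (1 : A) := by
          gcongr
          · exact CStarAlgebra.star_mul_self_le_one_of_norm_le_one hx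
          · exact CStarAlgebra.star_mul_self_le_one_of_norm_le_one hy
      _ = 1 := by rw [← add_smul, hab, one_smul]
  have hconj := star_right_conjugate_le_conjugate hle v
  have hzero : v * (1 - star v * v) * star v = 0 := by
    rw [mul_sub, mul_one, ← mul_assoc, hv, sub_self, zero_mul]
  have heq : v * ((a * b) • (star (x - y) * (x - y))) * star v =
      (a * b) • (star ((x - y) * star v) * ((x - y) * star v)) := by
    simp only [star_mul, star_star, mul_smul_comm, smul_mul_assoc, mul_assoc]
  rw [hzero, heq] at hconj
  have hpos := mul_pos ha hb
  have hsmul := le_antisymm hconj (smul_nonneg hpos.le (star_mul_self_nonneg _))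
  exact CStarRing.star_mul_self_eq_zero_iff _ |>.1 ((smul_eq_zero_iff_right hpos.ne').1 hsmul)

/-- **Kadison's theorem (sufficiency direction).**
Let `A` be a unital C*-algebra and let `v ∈ A` be a partial isometry
(`v * v* * v = v`) such that `(1 - v v*) a (1 - v* v) = 0` for every `a ∈ A`.
Then `v` is an extreme point of the closed unit ball of `A`. -/
theorem extremePoint_of_partialIsometry_of_annihilating
    {A : Type*} [CStarAlgebra A] (v : A)
    (hv : v * star v * v = v)
    (h : ∀ a : A, (1 - v * star v) * a * (1 - star v * v) = 0) :
    v ∈ Set.extremePoints ℝ {x : A | ‖x‖ ≤ 1} := by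
  have hv_star : star v * star (star v) * star v = star v := by
    simpa [mul_assoc] using congrArg star hv
  have hnorm : ‖v‖ ≤ 1 := by
    have hidem : IsSelfAdjoint (star v * v) := .star_mul_self v
    have hproj : IsStarProjection (star v * v) :=
      ⟨by rw [IsIdempotentElem, mul_assoc, ← mul_assoc v, hv], hidem⟩
    have hsq := hproj.norm_le
    rw [CStarRing.norm_star_mul_self] at hsq
    nlinarith [norm_nonneg v]
  refine mem_extremePoints_iff_left.2 ⟨hnorm, ?_⟩
  rintro x hx y hy ⟨a, b, ha, hb, hab, hxy⟩
  have hright := sub_mul_star_eq_zero_of_partialIsometry_eq_convexComb hv hx hy ha hb hab hxy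
  have hleft : star v * (x - y) = 0 := by
    have := sub_mul_star_eq_zero_of_partialIsometry_eq_convexComb (x := star x) (y := star y)
      hv_star (by simpa using hx) (by simpa using hy) ha hb hab (by simp [← hxy])
    simpa using congrArg star this
  have hsub : x - y = 0 := by
    have := h (x - y)
    rwa [sub_mul, one_mul, mul_assoc v, hleft, mul_zero, sub_zero, mul_sub, mul_one, ← mul_assoc,
      hright, zero_mul, sub_zero] at this
  obtain rfl := sub_eq_zero.1 hsub
  rw [← hxy, ← add_smul, hab, one_smul]
end

section
/- Let A be a unital C*-algebra and let x be an extreme point of the closed unit ball of A. Then x is a partial isometry (x x* x = x) and (1 - x x*) a (1 - x* x) = 0 for every a ∈ A. -/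
/-- An extreme point of a set is not the midpoint of a nontrivial segment in that set. -/
theorem eq_zero_of_add_mem_of_sub_mem_of_mem_extremePoints {E : Type*} [AddCommGroup E]
    [Module ℝ E] {s : Set E} {x z : E} (hx : x ∈ Set.extremePoints ℝ s)
    (h_add : x + z ∈ s) (h_sub : x - z ∈ s) : z = 0 := by
  have h : x ∈ openSegment ℝ (x + z) (x - z) :=
    ⟨1 / 2, 1 / 2, by norm_num, by norm_num, by norm_num, by module⟩
  simpa using hx.2 h_add h_sub h

section Order

variable {A : Type*} [CStarAlgebra A] [PartialOrder A] [StarOrderedRing A]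

theorem CStarAlgebra.norm_le_one_iff_star_mul_self_le_one {x : A} :
    ‖x‖ ≤ 1 ↔ star x * x ≤ 1 := by
  rw [← CStarAlgebra.norm_le_one_iff_of_nonneg _ (star_mul_self_nonneg x),
    CStarRing.norm_star_mul_self, ← sq, sq_le_one_iff₀ (norm_nonneg x)]

/-- On the unit ball, `x ↦ x (3 - x* x)` is bounded by `2`, because
`4 - p (3 - p) ^ 2 = (1 - p) (4 - p) (1 - p)`. -/
theorem CStarAlgebra.norm_add_half_smul_mul_one_sub_le_one {x : A} (hx : ‖x‖ ≤ 1) :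
    ‖x + (1 / 2 : ℝ) • (x * (1 - star x * x))‖ ≤ 1 := by
  rw [CStarAlgebra.norm_le_one_iff_star_mul_self_le_one] at hx ⊢
  set p := star x * x with hp
  have hp_star : star p = p := by simp [hp]
  have h_nonneg : 0 ≤ 1 - p := sub_nonneg.2 hx
  have h_factor : 0 ≤ star (1 - p) * ((3 : ℝ) • 1 + (1 - p)) * (1 - p) :=
    star_left_conjugate_nonneg
      (add_nonneg (smul_nonneg (by norm_num) zero_le_one) h_nonneg) _
  have h_eq : 1 - star (x + (1 / 2 : ℝ) • (x * (1 - p))) * (x + (1 / 2 : ℝ) • (x * (1 - p))) =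
      (1 / 4 : ℝ) • (star (1 - p) * ((3 : ℝ) • 1 + (1 - p)) * (1 - p)) := by
    have h_expand : star (x + (1 / 2 : ℝ) • (x * (1 - p))) * (x + (1 / 2 : ℝ) • (x * (1 - p))) =
        (1 + (1 / 2 : ℝ) • (1 - p)) * p * (1 + (1 / 2 : ℝ) • (1 - p)) := by
      simp only [star_add, star_smul, star_mul, star_sub, star_one, star_star, star_trivial, hp]
      simp only [mul_add, add_mul, smul_mul_assoc, mul_smul_comm, mul_assoc, one_mul, mul_one]
    rw [h_expand, star_sub, star_one, hp_star]
    simp only [mul_add, add_mul, mul_sub, sub_mul, smul_mul_assoc, mul_smul_comm, mul_assoc,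
      one_mul, mul_one, smul_sub, smul_add]
    module
  rw [← sub_nonneg, h_eq]
  exact smul_nonneg (by norm_num) h_factor

/-- A partial isometry plus a contraction with orthogonal range and initial space is a
contraction. -/
theorem CStarAlgebra.norm_add_le_one_of_mul_star_mul_self {x b : A} (hx : x * star x * x = x)
    (hb : ‖b‖ ≤ 1) (h_range : star x * b = 0) (h_init : b * (1 - star x * x) = b) :
    ‖x + b‖ ≤ 1 := by
  rw [CStarAlgebra.norm_le_one_iff_star_mul_self_le_one] at hb ⊢
  have h_range' : star b * x = 0 := by simpa using congrArg star h_range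
  have h_idem : star x * x * (star x * x) = star x * x := by
    rw [mul_assoc, ← mul_assoc x, hx]
  have h_conj := star_left_conjugate_le_conjugate hb (1 - star x * x)
  have h_left : star (1 - star x * x) * (star b * b) * (1 - star x * x) = star b * b := by
    rw [← mul_assoc, ← star_mul, h_init, mul_assoc, h_init]
  have h_right : star (1 - star x * x) * 1 * (1 - star x * x) = 1 - star x * x := by
    simp [mul_sub, sub_mul, h_idem]
  rw [h_left, h_right] at h_conj
  calc star (x + b) * (x + b) = star x * x + star b * b := by
        simp [mul_add, add_mul, h_range, h_range']
    _ ≤ star x * x + (1 - star x * x) := by gcongr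
    _ = 1 := by abel

end Order


/-- **Kadison's theorem (necessity direction).**
Let `A` be a unital C*-algebra and let `x` be an extreme point of the closed
unit ball of `A`. Then `x` is a partial isometry (`x x* x = x`) and
`(1 - x x*) a (1 - x* x) = 0` for every `a ∈ A`. -/
theorem partialIsometry_and_annihilating_of_extremePoint
    {A : Type*} [CStarAlgebra A] (x : A)
    (hx : x ∈ Set.extremePoints ℝ {y : A | ‖y‖ ≤ 1}) :
    x * star x * x = x ∧ ∀ a : A, (1 - x * star x) * a * (1 - star x * x) = 0 := by
  let _ : PartialOrder A := CStarAlgebra.spectralOrder A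
  have : StarOrderedRing A := CStarAlgebra.spectralOrderedRing A
  have hx_norm : ‖x‖ ≤ 1 := hx.1
  have h_isom : x * star x * x = x := by
    have h_sub : ‖x - (1 / 2 : ℝ) • (x * (1 - star x * x))‖ ≤ 1 := by
      have h_cube : ‖x * (star x * x)‖ ≤ 1 := by
        refine (norm_mul_le _ _).trans (mul_le_one₀ hx_norm (norm_nonneg _) ?_)
        rw [CStarRing.norm_star_mul_self]
        exact mul_le_one₀ hx_norm (norm_nonneg _) hx_norm
      have h_eq : x - (1 / 2 : ℝ) • (x * (1 - star x * x)) =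
          (1 / 2 : ℝ) • (x + x * (star x * x)) := by
        rw [mul_sub, mul_one]
        module
      rw [h_eq, norm_smul]
      norm_num
      linarith [norm_add_le x (x * (star x * x))]
    have h_zero := eq_zero_of_add_mem_of_sub_mem_of_mem_extremePoints hx
      (CStarAlgebra.norm_add_half_smul_mul_one_sub_le_one hx_norm) h_sub
    rw [smul_eq_zero_iff_right (by norm_num), mul_sub, mul_one, sub_eq_zero] at h_zero
    rw [mul_assoc, ← h_zero]
  refine ⟨h_isom, fun a => ?_⟩
  set b := (1 - x * star x) * a * (1 - star x * x) with hb
  have h_range : star x * b = 0 := by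
    have h_star : star x * x * star x = star x := by
      simpa [mul_assoc] using congrArg star h_isom
    rw [hb, ← mul_assoc, ← mul_assoc]
    simp [mul_sub (star x) 1, ← mul_assoc (star x) x, h_star]
  have h_init : b * (1 - star x * x) = b := by
    have h_idem : (1 - star x * x) * (1 - star x * x) = 1 - star x * x := by
      have : star x * x * (star x * x) = star x * x := by
        rw [mul_assoc, ← mul_assoc x, h_isom]
      simp [mul_sub, sub_mul, this]
    rw [hb, mul_assoc, h_idem]
  have h_pos : 0 < 1 + ‖b‖ := by positivity
  have h_norm : ‖(1 + ‖b‖)⁻¹ • b‖ ≤ 1 := by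
    rw [norm_smul, norm_inv, Real.norm_of_nonneg h_pos.le, inv_mul_le_one₀ h_pos]
    linarith
  have h_zero : (1 + ‖b‖)⁻¹ • b = 0 := by
    refine eq_zero_of_add_mem_of_sub_mem_of_mem_extremePoints hx
      (CStarAlgebra.norm_add_le_one_of_mul_star_mul_self h_isom h_norm ?_ ?_) ?_
    · rw [mul_smul_comm, h_range, smul_zero]
    · rw [smul_mul_assoc, h_init]
    · rw [sub_eq_add_neg]
      refine CStarAlgebra.norm_add_le_one_of_mul_star_mul_self h_isom (by rwa [norm_neg]) ?_ ?_
      · rw [mul_neg, mul_smul_comm, h_range, smul_zero, neg_zero]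
      · rw [neg_mul, smul_mul_assoc, h_init]
  exact (smul_eq_zero_iff_right (inv_ne_zero h_pos.ne')).1 h_zero
end

section
/- Let A be a unital C*-algebra, let p, q ∈ A be projections, and let e ∈ A satisfy p e q = e and e e* e = e. If (p - e e*) a (q - e* e) = 0 for every a ∈ A, then e is an extreme point of the closed unit ball of the corner p A q = {x ∈ A : p x q = x}. -/
/-- If a partial isometry `e` is a proper convex combination of two contractions `x` and `y`, then
`x - y` vanishes on the initial projection of `e`. -/
theorem sub_mul_star_mul_self_eq_zero_of_convex_combination
    {A : Type*} [CStarAlgebra A] [PartialOrder A] [StarOrderedRing A] {e x y : A} {s t : ℝ}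
    (he : e * star e * e = e) (hx : ‖x‖ ≤ 1) (hy : ‖y‖ ≤ 1) (hs : 0 < s) (ht : 0 < t)
    (hst : s + t = 1) (hexy : s • x + t • y = e) :
    (x - y) * (star e * e) = 0 := by
  have le_one {z : A} (hz : ‖z‖ ≤ 1) : star z * z ≤ 1 := by
    rw [← CStarAlgebra.norm_le_one_iff_of_nonneg _ (star_mul_self_nonneg z),
      CStarRing.norm_star_mul_self]
    exact mul_le_one₀ hz (norm_nonneg z) hz
  have convexity : s • (star x * x) + t • (star y * y)
      = star e * e + (s * t) • (star (x - y) * (x - y)) := by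
    obtain rfl : t = 1 - s := by linarith
    simp only [← hexy, star_add, star_sub, star_smul, star_trivial, add_mul, mul_add, sub_mul,
      mul_sub, smul_mul_assoc, mul_smul_comm]
    module
  have key : star e * e + (s * t) • (star (x - y) * (x - y)) ≤ 1 := by
    rw [← convexity]
    calc s • (star x * x) + t • (star y * y) ≤ s • (1 : A) + t • (1 : A) := by
          gcongr
          exacts [le_one hx, le_one hy]
      _ = 1 := by rw [← add_smul, hst, one_smul]
  have idem : star e * e * (star e * e) = star e * e := by
    rw [mul_assoc, ← mul_assoc e, he]
  have conj := star_left_conjugate_le_conjugate key (star e * e)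
  have expand : star (star e * e) * (star e * e + (s * t) • (star (x - y) * (x - y))) * (star e * e)
      = star e * e
        + (s * t) • (star ((x - y) * (star e * e)) * ((x - y) * (star e * e))) := by
    rw [star_mul (x - y), star_mul (star e), star_star, mul_add, add_mul, idem, idem,
      mul_smul_comm, smul_mul_assoc]
    simp only [mul_assoc]
  rw [expand, mul_one, star_mul (star e), star_star, idem, add_le_iff_nonpos_right] at conj
  have hzero := le_antisymm conj
    (smul_nonneg (mul_pos hs ht).le (star_mul_self_nonneg _))
  rw [smul_eq_zero_iff_right (mul_pos hs ht).ne'] at hzero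
  exact CStarRing.star_mul_self_eq_zero_iff _ |>.mp hzero

/-- A partial isometry is a contraction. -/
theorem norm_le_one_of_mul_star_mul_self {A : Type*} [CStarAlgebra A] {e : A}
    (he : e * star e * e = e) : ‖e‖ ≤ 1 := by
  have hproj : IsStarProjection (star e * e) :=
    ⟨by rw [IsIdempotentElem, mul_assoc, ← mul_assoc e, he], .star_mul_self e⟩
  have hnorm := hproj.norm_le
  rw [CStarRing.norm_star_mul_self] at hnorm
  nlinarith [norm_nonneg e]

/-- **Corner version of Kadison's theorem (sufficiency direction).**
Let `A` be a unital C*-algebra, let `p, q ∈ A` be projections, and let `e ∈ A`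
satisfy `p e q = e` and `e e* e = e`.  If `(p - e e*) a (q - e* e) = 0` for
every `a ∈ A`, then `e` is an extreme point of the closed unit ball of the
corner `p A q = {x ∈ A : p x q = x}`. -/
theorem extremePoint_of_corner_partialIsometry
    {A : Type*} [CStarAlgebra A] (p q e : A)
    (hp : star p = p) (hp2 : p * p = p)
    (hq : star q = q) (hq2 : q * q = q)
    (hpq : p * e * q = e) (he : e * star e * e = e)
    (h : ∀ a : A, (p - e * star e) * a * (q - star e * e) = 0) :
    e ∈ Set.extremePoints ℝ {x : A | p * x * q = x ∧ ‖x‖ ≤ 1} := by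
  let := CStarAlgebra.spectralOrder A
  have := CStarAlgebra.spectralOrderedRing A
  rw [mem_extremePoints_iff_left]
  refine ⟨⟨hpq, norm_le_one_of_mul_star_mul_self he⟩, ?_⟩
  rintro x ⟨hpx, hx⟩ y ⟨hpy, hy⟩ ⟨s, t, hs, ht, hst, hexy⟩
  have hright := sub_mul_star_mul_self_eq_zero_of_convex_combination he hx hy hs ht hst hexy
  have hleft : e * star e * (x - y) = 0 := by
    have := sub_mul_star_mul_self_eq_zero_of_convex_combination (e := star e)
      (by simpa [mul_assoc] using congrArg star he) ((norm_star x).trans_le hx)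
      ((norm_star y).trans_le hy) hs ht hst (by simp [← hexy])
    simpa [mul_assoc] using congrArg star this
  have hxy : x - y = 0 := by
    calc x - y = p * (x - y) * q := by rw [mul_sub, sub_mul, hpx, hpy]
      _ = (p - e * star e) * (x - y) * (q - star e * e) := by
        rw [sub_mul p, hleft, sub_zero, mul_sub _ q, mul_assoc p _ (star e * e), hright, mul_zero,
          sub_zero]
      _ = 0 := h (x - y)
  rw [← hexy, ← sub_eq_zero.mp hxy, ← add_smul, hst, one_smul]
end

section
/- Let A be a unital C*-algebra, let p, q ∈ A be projections, and let r, t, l ∈ A be pairwise orthogonal central projections with r + t + l = 1. Suppose u, v, w ∈ A are partial isometries with u u* = r p, u* u ≤ r q, v v* = t p, v* v = t q, w w* ≤ l p, and w* w = l q. Then e := u + v + w satisfies p e q = e, e e* e = e, and (p - e e*) a (q - e* e) = 0 for every a ∈ A. -/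
/-- Elements supported on orthogonal projections, one of them central, multiply to zero. -/
theorem mul_eq_zero_of_central_orthogonal {R : Type*} [Ring R] {z z' x y : R}
    (hz : ∀ a : R, z * a = a * z) (hzz : z * z' = 0) (hx : z * x = x) (hy : z' * y = y) :
    x * y = 0 := by
  rw [← hx, ← hy, hz, mul_assoc, ← mul_assoc z, hzz, zero_mul, mul_zero]

/-- A central projection supporting `x` also supports `star x`. -/
theorem mul_star_eq_of_central {R : Type*} [Ring R] [StarRing R] {z x : R}
    (hzs : star z = z) (hz : ∀ a : R, z * a = a * z) (hx : z * x = x) : z * star x = star x := by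
  rw [hz, ← hzs, ← star_mul, hx]

/-- If the source projection of a partial isometry `x` is below a projection, then that projection
fixes `x` on the right. -/
theorem mul_eq_of_star_mul_self_le {A : Type*} [CStarAlgebra A] [PartialOrder A]
    [StarOrderedRing A] {x f : A} (hx : x * star x * x = x) (hf : IsStarProjection f)
    (h : star x * x ≤ f) : x * f = x := by
  have hs : IsStarProjection (star x * x) :=
    ⟨by rw [IsIdempotentElem, mul_assoc, ← mul_assoc x, hx], IsSelfAdjoint.star_mul_self x⟩
  have := (hs.le_iff_mul_eq_left hf).mp h
  calc x * f = x * (star x * x * f) := by rw [← mul_assoc, ← mul_assoc, hx]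
    _ = x := by rw [this, ← mul_assoc, hx]

/-- The product of a central projection with a projection is a projection. -/
theorem isStarProjection_mul_of_central {R : Type*} [Ring R] [StarRing R] {z p : R}
    (hzs : star z = z) (hz2 : z * z = z) (hz : ∀ a : R, z * a = a * z)
    (hp : star p = p) (hp2 : p * p = p) : IsStarProjection (z * p) :=
  ⟨by rw [IsIdempotentElem, mul_assoc, ← mul_assoc p, ← hz p, mul_assoc, hp2, ← mul_assoc, hz2],
    by rw [IsSelfAdjoint, star_mul, hp, hzs, hz]⟩

/-- A partial isometry between corners `z * p` and `z * q`, with `z` a central projection, is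
supported on `z` and lies in `p A q`. -/
theorem corner_of_partialIsometry_le {A : Type*} [CStarAlgebra A] [PartialOrder A]
    [StarOrderedRing A] {z p q x : A}
    (hzs : star z = z) (hz2 : z * z = z) (hz : ∀ a : A, z * a = a * z)
    (hp : star p = p) (hp2 : p * p = p) (hq : star q = q) (hq2 : q * q = q)
    (hx : x * star x * x = x) (hl : x * star x ≤ z * p) (hr : star x * x ≤ z * q) :
    z * x = x ∧ p * x = x ∧ x * q = x := by
  have hR := mul_eq_of_star_mul_self_le hx (isStarProjection_mul_of_central hzs hz2 hz hq hq2) hr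
  have hL := mul_eq_of_star_mul_self_le (x := star x)
    (by simpa [mul_assoc] using congrArg star hx)
    (isStarProjection_mul_of_central hzs hz2 hz hp hp2) (by simpa using hl)
  have hL' : p * z * x = x := by simpa [hp, hzs] using congrArg star hL
  refine ⟨?_, ?_, ?_⟩
  · rw [← hL', ← hz p, ← mul_assoc, ← mul_assoc, hz2]
  · rw [← hL', ← mul_assoc, ← mul_assoc, hp2]
  · rw [← hR, mul_assoc, mul_assoc, hq2]

/-- **Key construction in the proof of the main theorem.**
Let `A` be a unital C*-algebra, let `p, q ∈ A` be projections, and let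
`r, t, l ∈ A` be pairwise orthogonal central projections with `r + t + l = 1`.
Suppose `u, v, w ∈ A` are partial isometries with `u u* = r p`, `u* u ≤ r q`,
`v v* = t p`, `v* v = t q`, `w w* ≤ l p`, and `w* w = l q`.  Then
`e := u + v + w` satisfies `p e q = e`, `e e* e = e`, and
`(p - e e*) a (q - e* e) = 0` for every `a ∈ A`. -/
theorem sum_partialIsometries_is_corner_extremal_partialIsometry
    {A : Type*} [CStarAlgebra A] [PartialOrder A] [StarOrderedRing A]
    (p q r t l u v w : A)
    (hp : star p = p) (hp2 : p * p = p)
    (hq : star q = q) (hq2 : q * q = q)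
    (hr : star r = r) (hr2 : r * r = r) (hrc : ∀ a : A, r * a = a * r)
    (ht : star t = t) (ht2 : t * t = t) (htc : ∀ a : A, t * a = a * t)
    (hl : star l = l) (hl2 : l * l = l) (hlc : ∀ a : A, l * a = a * l)
    (hrt : r * t = 0) (hrl : r * l = 0) (htl : t * l = 0)
    (hsum : r + t + l = 1)
    (hu : u * star u * u = u) (hv : v * star v * v = v) (hw : w * star w * w = w)
    (huu : u * star u = r * p) (huu' : star u * u ≤ r * q)
    (hvv : v * star v = t * p) (hvv' : star v * v = t * q)
    (hww : w * star w ≤ l * p) (hww' : star w * w = l * q) :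
    p * (u + v + w) * q = u + v + w ∧
    (u + v + w) * star (u + v + w) * (u + v + w) = u + v + w ∧
    ∀ a : A, (p - (u + v + w) * star (u + v + w)) * a *
      (q - star (u + v + w) * (u + v + w)) = 0 := by
  obtain ⟨hru, hpu, huq⟩ := corner_of_partialIsometry_le hr hr2 hrc hp hp2 hq hq2 hu huu.le huu'
  obtain ⟨htv, hpv, hvq⟩ := corner_of_partialIsometry_le ht ht2 htc hp hp2 hq hq2 hv hvv.le hvv'.le
  obtain ⟨hlw, hpw, hwq⟩ := corner_of_partialIsometry_le hl hl2 hlc hp hp2 hq hq2 hw hww hww'.le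
  have hru' := mul_star_eq_of_central hr hrc hru
  have htv' := mul_star_eq_of_central ht htc htv
  have hlw' := mul_star_eq_of_central hl hlc hlw
  have htr : t * r = 0 := by rw [← hrc, hrt]
  have hlr : l * r = 0 := by rw [← hrc, hrl]
  have hlt : l * t = 0 := by rw [← htc, htl]
  have hee : (u + v + w) * star (u + v + w) = u * star u + v * star v + w * star w := by
    simp only [star_add, add_mul, mul_add,
      mul_eq_zero_of_central_orthogonal hrc hrt hru htv',
      mul_eq_zero_of_central_orthogonal hrc hrl hru hlw',
      mul_eq_zero_of_central_orthogonal htc htr htv hru',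
      mul_eq_zero_of_central_orthogonal htc htl htv hlw',
      mul_eq_zero_of_central_orthogonal hlc hlr hlw hru',
      mul_eq_zero_of_central_orthogonal hlc hlt hlw htv', add_zero, zero_add]
  have hee' : star (u + v + w) * (u + v + w) = star u * u + star v * v + star w * w := by
    simp only [star_add, add_mul, mul_add,
      mul_eq_zero_of_central_orthogonal hrc hrt hru' htv,
      mul_eq_zero_of_central_orthogonal hrc hrl hru' hlw,
      mul_eq_zero_of_central_orthogonal htc htr htv' hru,
      mul_eq_zero_of_central_orthogonal htc htl htv' hlw,
      mul_eq_zero_of_central_orthogonal hlc hlr hlw' hru,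
      mul_eq_zero_of_central_orthogonal hlc hlt hlw' htv, add_zero, zero_add]
  refine ⟨?_, ?_, fun a => ?_⟩
  · simp only [mul_add, add_mul, hpu, hpv, hpw, huq, hvq, hwq]
  · rw [hee]
    simp only [add_mul, mul_add, hu, hv, hw, mul_assoc,
      mul_eq_zero_of_central_orthogonal hrc hrt hru' htv,
      mul_eq_zero_of_central_orthogonal hrc hrl hru' hlw,
      mul_eq_zero_of_central_orthogonal htc htr htv' hru,
      mul_eq_zero_of_central_orthogonal htc htl htv' hlw,
      mul_eq_zero_of_central_orthogonal hlc hlr hlw' hru,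
      mul_eq_zero_of_central_orthogonal hlc hlt hlw' htv, mul_zero, add_zero, zero_add]
  · have hP : p - (u + v + w) * star (u + v + w) = l * p - w * star w := by
      rw [hee, huu, hvv]
      nth_rewrite 1 [← one_mul p]
      rw [← hsum]
      noncomm_ring
    have hQ : q - star (u + v + w) * (u + v + w) = r * q - star u * u := by
      rw [hee', hvv', hww']
      nth_rewrite 1 [← one_mul q]
      rw [← hsum]
      noncomm_ring
    rw [hP, hQ]
    refine mul_eq_zero_of_central_orthogonal hlc hlr ?_ ?_
    · rw [← mul_assoc, mul_sub, ← mul_assoc, ← mul_assoc, hl2, hlw]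
    · rw [mul_sub, ← mul_assoc, ← mul_assoc, hr2, hru']
end

section
/- Let A be a unital C*-algebra, let p, q ∈ A be projections, and let r, t, l ∈ A be pairwise orthogonal central projections with r + t + l = 1. Suppose u, v, w ∈ A are partial isometries with u u* = r p, u* u ≤ r q, v v* = t p, v* v = t q, w w* ≤ l p, and w* w = l q. Then u + v + w is an extreme point of the closed unit ball of the corner p A q = {x ∈ A : p x q = x}; in particular this closed unit ball has an extreme point. -/
section CStarAlgebra

variable {A : Type*} [CStarAlgebra A] [PartialOrder A] [StarOrderedRing A]

/-- A projection dominating the range projection of `a` fixes `a`. -/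
theorem IsStarProjection.mul_eq_self_of_mul_star_le {P a : A} (hP : IsStarProjection P)
    (h : a * star a ≤ P) : P * a = a := by
  have hs : star (1 - P) = 1 - P := by rw [star_sub, star_one, hP.isSelfAdjoint.star_eq]
  have hPP : P * P = P := hP.isIdempotentElem
  have h1 := star_right_conjugate_le_conjugate h (1 - P)
  have h2 : (1 - P) * P * star (1 - P) = 0 := by
    rw [sub_mul, one_mul, hPP, sub_self, zero_mul]
  have h3 : (1 - P) * (a * star a) * star (1 - P) = ((1 - P) * a) * star ((1 - P) * a) := by
    rw [star_mul]; noncomm_ring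
  rw [h2, h3] at h1
  have h4 := CStarRing.mul_star_self_eq_zero_iff _ |>.mp (le_antisymm h1 (mul_star_self_nonneg _))
  rw [sub_mul, one_mul, sub_eq_zero] at h4
  exact h4.symm

theorem norm_le_one_of_star_mul_self_le_one {a : A} (h : star a * a ≤ 1) : ‖a‖ ≤ 1 := by
  have h1 := (CStarAlgebra.norm_le_one_iff_of_nonneg _ (star_mul_self_nonneg a)).mpr h
  rw [CStarRing.norm_star_mul_self] at h1
  nlinarith [norm_nonneg a]

/-- Cutting a contraction by a projection `P` gives an element with range under `P`. -/
theorem IsStarProjection.mul_mul_star_mul_le {P x : A} (hP : IsStarProjection P)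
    (hx : ‖x‖ ≤ 1) : (P * x) * star (P * x) ≤ P := by
  have h1 : x * star x ≤ 1 := by
    rw [← CStarAlgebra.norm_le_one_iff_of_nonneg _ (mul_star_self_nonneg x),
      CStarRing.norm_self_mul_star]
    exact mul_le_one₀ hx (norm_nonneg x) hx
  have h2 := star_right_conjugate_le_conjugate h1 P
  rw [mul_one, hP.isSelfAdjoint.star_eq, show P * P = P from hP.isIdempotentElem] at h2
  rwa [star_mul, hP.isSelfAdjoint.star_eq, mul_assoc, ← mul_assoc x, ← mul_assoc]

/-- A point at which the cut by `P` is a coisometry onto `P` determines the cut by `P` of the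
endpoints of any segment of contractions through it. -/
theorem IsStarProjection.mul_eq_of_mem_openSegment {P x y e : A} (hP : IsStarProjection P)
    (hx : ‖x‖ ≤ 1) (hy : ‖y‖ ≤ 1) (he : e ∈ openSegment ℝ x y)
    (hPe : (P * e) * star (P * e) = P) : P * x = P * e := by
  obtain ⟨a, b, ha, hb, hab, rfl⟩ := he
  obtain rfl : b = 1 - a := by linarith
  have hX := hP.mul_mul_star_mul_le hx
  have hY := hP.mul_mul_star_mul_le hy
  rw [mul_add, mul_smul_comm, mul_smul_comm] at hPe ⊢
  generalize P * x = X at *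
  generalize P * y = Y at *
  have key : a • (X * star X) + (1 - a) • (Y * star Y) =
      (a • X + (1 - a) • Y) * star (a • X + (1 - a) • Y) +
        (a * (1 - a)) • ((X - Y) * star (X - Y)) := by
    simp only [star_add, star_sub, star_smul, star_trivial, add_mul, mul_add, sub_mul, mul_sub,
      smul_mul_assoc, mul_smul_comm]
    module
  have h1 : a • (X * star X) + (1 - a) • (Y * star Y) ≤ a • P + (1 - a) • P :=
    add_le_add (smul_le_smul_of_nonneg_left hX ha.le) (smul_le_smul_of_nonneg_left hY hb.le)
  rw [key, hPe, ← add_smul, add_sub_cancel, one_smul, add_le_iff_nonpos_right] at h1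
  have hpos : 0 < a * (1 - a) := mul_pos ha hb
  have h2 := le_antisymm h1 (smul_nonneg hpos.le (mul_star_self_nonneg (X - Y)))
  have h3 := (smul_eq_zero.mp h2).resolve_left hpos.ne'
  rw [CStarRing.mul_star_self_eq_zero_iff, sub_eq_zero] at h3
  rw [← h3, ← add_smul, add_sub_cancel, one_smul]

end CStarAlgebra


/-- **Main theorem (concrete C*-algebraic content).**
Let `A` be a unital C*-algebra, let `p, q ∈ A` be projections, and let
`r, t, l ∈ A` be pairwise orthogonal central projections with `r + t + l = 1`.
Suppose `u, v, w ∈ A` are partial isometries with `u u* = r p`, `u* u ≤ r q`,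
`v v* = t p`, `v* v = t q`, `w w* ≤ l p`, and `w* w = l q`.  Then `u + v + w`
is an extreme point of the closed unit ball of the corner
`p A q = {x ∈ A : p x q = x}`; in particular this closed unit ball has an
extreme point. -/
theorem sum_partialIsometries_extremePoint_of_corner_unitBall
    {A : Type*} [CStarAlgebra A] [PartialOrder A] [StarOrderedRing A]
    (p q r t l u v w : A)
    (hp : star p = p) (hp2 : p * p = p)
    (hq : star q = q) (hq2 : q * q = q)
    (hr : star r = r) (hr2 : r * r = r) (hrc : ∀ a : A, r * a = a * r)
    (ht : star t = t) (ht2 : t * t = t) (htc : ∀ a : A, t * a = a * t)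
    (hl : star l = l) (hl2 : l * l = l) (hlc : ∀ a : A, l * a = a * l)
    (hrt : r * t = 0) (hrl : r * l = 0) (htl : t * l = 0)
    (hsum : r + t + l = 1)
    (hu : u * star u * u = u) (hv : v * star v * v = v) (hw : w * star w * w = w)
    (huu : u * star u = r * p) (huu' : star u * u ≤ r * q)
    (hvv : v * star v = t * p) (hvv' : star v * v = t * q)
    (hww : w * star w ≤ l * p) (hww' : star w * w = l * q) :
    (u + v + w) ∈ Set.extremePoints ℝ {x : A | p * x * q = x ∧ ‖x‖ ≤ 1} ∧
    (Set.extremePoints ℝ {x : A | p * x * q = x ∧ ‖x‖ ≤ 1}).Nonempty := by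
  have hP : ∀ {z g : A}, star z = z → z * z = z → (∀ a : A, z * a = a * z) → star g = g →
      g * g = g → IsStarProjection (z * g) := fun {z g} hz hz2 hzc hg hg2 =>
    ⟨by rw [IsIdempotentElem, mul_assoc, ← mul_assoc g, ← hzc g, mul_assoc z g g, hg2,
        ← mul_assoc, hz2],
      by rw [isSelfAdjoint_iff, star_mul, hz, hg, hzc]⟩
  -- supports of the three partial isometries
  have huL : r * p * u = u := by rw [← huu, hu]
  have hvL : t * p * v = v := by rw [← hvv, hv]
  have hwL : l * p * w = w := (hP hl hl2 hlc hp hp2).mul_eq_self_of_mul_star_le hww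
  have huR : u * (r * q) = u := by
    have h := (hP hr hr2 hrc hq hq2).mul_eq_self_of_mul_star_le (a := star u) (by rwa [star_star])
    simpa [(hP hr hr2 hrc hq hq2).isSelfAdjoint.star_eq] using congrArg star h
  have hvR : v * (t * q) = v := by rw [← hvv', ← mul_assoc, hv]
  have hwR : w * (l * q) = w := by rw [← hww', ← mul_assoc, hw]
  have absL : ∀ {z g x : A}, z * z = z → z * g * x = x → z * x = x := fun {z g x} hz h => by
    rw [← h, ← mul_assoc, ← mul_assoc, hz]
  have absP : ∀ {z x : A}, (∀ a : A, z * a = a * z) → z * p * x = x → p * x = x :=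
    fun {z x} hz h => by rw [← h, hz p, ← mul_assoc, ← mul_assoc, hp2]
  have absQ : ∀ {z x : A}, x * (z * q) = x → x * q = x := fun {z x} h => by
    rw [← h, mul_assoc, mul_assoc z, hq2]
  have hru := absL hr2 huL
  have htv := absL ht2 hvL
  have hlw := absL hl2 hwL
  have htr : t * r = 0 := by rw [htc, hrt]
  have hlr : l * r = 0 := by rw [hlc, hrl]
  have hlt : l * t = 0 := by rw [hlc, htl]
  have orth : ∀ {z z' x : A}, z * z' = 0 → z' * x = x → z * x = 0 := fun {z z' x} h hx => by
    rw [← hx, ← mul_assoc, h, zero_mul]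
  have cross : ∀ {z x y : A}, star z = z → z * x = x → z * y = 0 → star x * y = 0 :=
    fun {z x y} hz hx hy => by rw [← hx, star_mul, hz, mul_assoc, hy, mul_zero]
  have hrv := orth hrt htv
  have hrw := orth hrl hlw
  have htu := orth htr hru
  have htw := orth htl hlw
  have hlu := orth hlr hru
  have hlv := orth hlt htv
  have hle : l * (u + v + w) = w := by rw [mul_add, mul_add, hlu, hlv, hlw]; simp
  have hqproj : IsStarProjection q := ⟨hq2, hq⟩
  -- membership in the unit ball of the corner
  have hpe : p * (u + v + w) = u + v + w := by
    rw [mul_add, mul_add, absP hrc huL, absP htc hvL, absP hlc hwL]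
  have heq : (u + v + w) * q = u + v + w := by
    rw [add_mul, add_mul, absQ huR, absQ hvR, absQ hwR]
  have hnorm : ‖u + v + w‖ ≤ 1 := by
    refine norm_le_one_of_star_mul_self_le_one ?_
    have h : star (u + v + w) * (u + v + w) = star u * u + star v * v + star w * w := by
      simp only [star_add, add_mul, mul_add, cross hr hru hrv, cross hr hru hrw,
        cross ht htv htu, cross ht htv htw, cross hl hlw hlu, cross hl hlw hlv]
      simp
    rw [h, hvv', hww']
    calc star u * u + t * q + l * q ≤ r * q + t * q + l * q := by gcongr
      _ = q := by rw [← add_mul, ← add_mul, hsum, one_mul]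
      _ ≤ 1 := hqproj.le_one
  have hmain : (u + v + w) ∈ Set.extremePoints ℝ {x : A | p * x * q = x ∧ ‖x‖ ≤ 1} := by
    refine mem_extremePoints_iff_left.mpr ⟨⟨by rw [hpe, heq], hnorm⟩, ?_⟩
    rintro x ⟨hxc, hx⟩ y ⟨-, hy⟩ hseg
    have hpx : p * x = x := by rw [← hxc, ← mul_assoc, ← mul_assoc, hp2]
    have hxq : x * q = x := by rw [← hxc, mul_assoc, hq2]
    have hR : r * x = r * (u + v + w) := by
      have h := (hP hr hr2 hrc hp hp2).mul_eq_of_mem_openSegment hx hy hseg (by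
        rw [mul_assoc r p (u + v + w), hpe, mul_add, mul_add, hru, hrv, hrw, add_zero, add_zero, huu])
      rwa [mul_assoc, mul_assoc, hpx, hpe] at h
    have hT : t * x = t * (u + v + w) := by
      have h := (hP ht ht2 htc hp hp2).mul_eq_of_mem_openSegment hx hy hseg (by
        rw [mul_assoc t p (u + v + w), hpe, mul_add, mul_add, htu, htv, htw, add_zero, zero_add, hvv])
      rwa [mul_assoc, mul_assoc, hpx, hpe] at h
    have hL : l * x = l * (u + v + w) := by
      have hseg' : star (u + v + w) ∈ openSegment ℝ (star x) (star y) := by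
        obtain ⟨a, b, ha, hb, hab, h⟩ := hseg
        exact ⟨a, b, ha, hb, hab, by rw [← h]; simp⟩
      have hcut : ∀ {z : A}, z * q = z → l * q * star z = star (l * z) := fun {z} hz => by
        rw [mul_assoc, ← hq, ← star_mul, hz, ← hl, ← star_mul, hl, hlc]
      have h := (hP hl hl2 hlc hq hq2).mul_eq_of_mem_openSegment
        (by rwa [norm_star]) (by rwa [norm_star]) hseg' (by
          rw [hcut heq, hle, star_star, hww'])
      rw [hcut hxq, hcut heq] at h
      exact star_injective h
    rw [← one_mul x, ← hsum, add_mul, add_mul, hR, hT, hL, ← add_mul, ← add_mul, hsum, one_mul]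
  exact ⟨hmain, _, hmain⟩
end

section
/- Let H be a complex Hilbert space and let p, q be orthogonal projections on H (bounded operators with p = p* = p² and q = q* = q²). Then either there exists a partial isometry u ∈ B(H) with u u* = p and u* u ≤ q, or there exists a partial isometry u ∈ B(H) with u u* ≤ p and u* u = q. -/
/-- Of two Hilbert spaces, one embeds isometrically into the other. -/
theorem LinearIsometry.nonempty_total (𝕜 : Type*) [RCLike 𝕜] (E F : Type*)
    [NormedAddCommGroup E] [InnerProductSpace 𝕜 E] [CompleteSpace E]
    [NormedAddCommGroup F] [InnerProductSpace 𝕜 F] [CompleteSpace F] :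
    Nonempty (E →ₗᵢ[𝕜] F) ∨ Nonempty (F →ₗᵢ[𝕜] E) := by
  obtain ⟨_, b, -⟩ := exists_hilbertBasis 𝕜 E
  obtain ⟨_, c, -⟩ := exists_hilbertBasis 𝕜 F
  exact (Function.Embedding.total _ _).imp
    (fun ⟨f⟩ ↦ ⟨(c.orthonormal.comp f f.injective).orthogonalFamily.linearIsometry.comp
      b.repr.toLinearIsometry⟩)
    (fun ⟨f⟩ ↦ ⟨(b.orthonormal.comp f f.injective).orthogonalFamily.linearIsometry.comp
      c.repr.toLinearIsometry⟩)

theorem Submodule.completeSpace_of_hasOrthogonalProjection {𝕜 H : Type*} [RCLike 𝕜]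
    [NormedAddCommGroup H] [InnerProductSpace 𝕜 H] [CompleteSpace H]
    (K : Submodule 𝕜 H) [K.HasOrthogonalProjection] : CompleteSpace K := by
  have h := Kᗮ.isClosed_orthogonal
  rw [K.orthogonal_orthogonal] at h
  exact h.completeSpace_coe

/-- If the source projection `star w * w` of a partial isometry `w` is `p` and `q * w = w`, then
its range projection is at most `q`. -/
theorem IsStarProjection.mul_star_self_le {R : Type*} [NonUnitalRing R] [PartialOrder R]
    [StarRing R] [StarOrderedRing R] {p q w : R} (hq : IsStarProjection q)
    (hw : star w * w = p) (hwp : w * p = w) (hqw : q * w = w) : w * star w ≤ q := by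
  refine IsStarProjection.le_of_mul_eq_right ⟨?_, .mul_star_self w⟩ hq (by rw [← mul_assoc, hqw])
  rw [IsIdempotentElem, ← mul_assoc, mul_assoc w, hw, hwp]

open ContinuousLinearMap in
/-- An isometry between closed subspaces extends by zero to a partial isometry. -/
theorem LinearIsometry.exists_partialIsometry {H : Type*}
    [NormedAddCommGroup H] [InnerProductSpace ℂ H] [CompleteSpace H]
    {K L : Submodule ℂ H} [CompleteSpace K] [CompleteSpace L] (V : K →ₗᵢ[ℂ] L) :
    ∃ w : H →L[ℂ] H, w * star w * w = w ∧ star w * w = K.starProjection ∧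
      w * star w ≤ L.starProjection := by
  have hV : adjoint V.toContinuousLinearMap ∘L V.toContinuousLinearMap = 1 :=
    (norm_map_iff_adjoint_comp_self _).1 V.norm_map
  let w : H →L[ℂ] H := L.subtypeL ∘L V.toContinuousLinearMap ∘L K.orthogonalProjectionOnto
  have hw : star w * w = K.starProjection := by
    ext x
    have h : adjoint V.toContinuousLinearMap (V (K.orthogonalProjectionOnto x)) =
      K.orthogonalProjectionOnto x := DFunLike.congr_fun hV _
    simp [w, star_eq_adjoint, adjoint_comp, Submodule.adjoint_subtypeL,
      Submodule.adjoint_orthogonalProjectionOnto, h]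
  have hwK : w * K.starProjection = w := by
    ext x
    simp [w, Submodule.starProjection_apply, -Submodule.coe_orthogonalProjectionOnto_apply]
  have hLw : L.starProjection * w = w := by
    ext x
    simp [w]
  exact ⟨w, by rw [mul_assoc, hw, hwK], hw,
    isStarProjection_starProjection.mul_star_self_le hw hwK hLw⟩

/-- **Comparison theorem for projections in `B(H)`.**
Let `H` be a complex Hilbert space and let `p, q` be orthogonal projections on
`H`.  Then either there exists a partial isometry `u ∈ B(H)` with `u u* = p`
and `u* u ≤ q`, or there exists a partial isometry `u ∈ B(H)` with `u u* ≤ p`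
and `u* u = q`. -/
theorem comparison_of_projections
    {H : Type*} [NormedAddCommGroup H] [InnerProductSpace ℂ H] [CompleteSpace H]
    (p q : H →L[ℂ] H)
    (hp : star p = p) (hp2 : p * p = p)
    (hq : star q = q) (hq2 : q * q = q) :
    (∃ u : H →L[ℂ] H, u * star u * u = u ∧ u * star u = p ∧ star u * u ≤ q) ∨
    (∃ u : H →L[ℂ] H, u * star u * u = u ∧ u * star u ≤ p ∧ star u * u = q) := by
  obtain ⟨K, _, rfl⟩ := isStarProjection_iff_eq_starProjection.1 ⟨hp2, hp⟩
  obtain ⟨L, _, rfl⟩ := isStarProjection_iff_eq_starProjection.1 ⟨hq2, hq⟩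
  have : CompleteSpace K := K.completeSpace_of_hasOrthogonalProjection
  have : CompleteSpace L := L.completeSpace_of_hasOrthogonalProjection
  rcases LinearIsometry.nonempty_total ℂ K L with ⟨⟨V⟩⟩ | ⟨⟨V⟩⟩
  · obtain ⟨w, hw, hwK, hwL⟩ := V.exists_partialIsometry
    exact .inl ⟨star w, by simpa [mul_assoc] using congrArg star hw, by rwa [star_star],
      by rwa [star_star]⟩
  · obtain ⟨w, hw, hwL, hwK⟩ := V.exists_partialIsometry
    exact .inr ⟨w, hw, hwK, hwL⟩
end

section
/- Let A be a unital C*-algebra, let p, q ∈ A be projections, let r, t, l ∈ A be pairwise orthogonal central projections with r + t + l = 1, and let u, v, w ∈ A be partial isometries with u u* = r p, u* u ≤ r q, v v* = t p, v* v = t q, w w* ≤ l p, and w* w = l q. Set e := u + v + w. Then for every x ∈ A with p x q = x, max(‖(t + l) x e*‖, ‖e* (r x)‖) = ‖x‖. -/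
/-- The norm of a sum of two elements with orthogonal left and right supports is the maximum of
their norms. -/
theorem norm_add_eq_max_of_star_mul_eq_zero {A : Type*} [CStarAlgebra A] {a b : A}
    (h : star a * b = 0) (h' : a * star b = 0) : ‖a + b‖ = max ‖a‖ ‖b‖ := by
  have hba : star b * a = 0 := by simpa using congrArg star h
  have key := (IsSelfAdjoint.star_mul_self a).norm_add_eq_max (IsSelfAdjoint.star_mul_self b)
    (by rw [mul_assoc, ← mul_assoc a, h', zero_mul, mul_zero])
  have hsq : star (a + b) * (a + b) = star a * a + star b * b := by
    simp [add_mul, mul_add, h, hba]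
  rw [← hsq] at key
  simp only [CStarRing.norm_star_mul_self] at key
  rcases le_total ‖a‖ ‖b‖ with hab | hab
  · rw [max_eq_right (mul_self_le_mul_self (norm_nonneg a) hab)] at key
    rw [max_eq_right hab]
    exact (mul_self_inj (norm_nonneg _) (norm_nonneg _)).1 key
  · rw [max_eq_left (mul_self_le_mul_self (norm_nonneg b) hab)] at key
    rw [max_eq_left hab]
    exact (mul_self_inj (norm_nonneg _) (norm_nonneg _)).1 key

/-- Right multiplication by `star e` preserves the norm of `y` if `star e * e` fixes `y`. -/
theorem norm_mul_star_of_mul_star_mul_eq {A : Type*} [CStarAlgebra A] {y e : A}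
    (h : y * (star e * e) = y) : ‖y * star e‖ = ‖y‖ := by
  have hsq : y * star e * star (y * star e) = y * star y := by
    rw [star_mul, star_star, ← mul_assoc, mul_assoc y, h]
  refine (mul_self_inj (norm_nonneg _) (norm_nonneg _)).1 ?_
  rw [← CStarRing.norm_self_mul_star, hsq, CStarRing.norm_self_mul_star]

/-- Left multiplication by `star e` preserves the norm of `y` if `e * star e` fixes `y`. -/
theorem norm_star_mul_of_mul_star_mul_eq {A : Type*} [CStarAlgebra A] {y e : A}
    (h : e * star e * y = y) : ‖star e * y‖ = ‖y‖ := by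
  have := norm_mul_star_of_mul_star_mul_eq (y := star y) (e := star e)
    (by simpa [mul_assoc] using congrArg star h)
  rw [← norm_star (star e * y), star_mul, this, norm_star]


/-- **Isometry of the ideal-decomposition map.**
Let `A` be a unital C*-algebra, `p, q` projections, `r, t, l` pairwise
orthogonal central projections with `r + t + l = 1`, and `u, v, w` partial
isometries with `u u* = r p`, `u* u ≤ r q`, `v v* = t p`, `v* v = t q`,
`w w* ≤ l p`, and `w* w = l q`.  Set `e := u + v + w`.  Then for every
`x ∈ A` with `p x q = x`, `max (‖(t + l) x e*‖, ‖e* (r x)‖) = ‖x‖`. -/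
theorem max_norm_ideal_decomposition
    {A : Type*} [CStarAlgebra A] [PartialOrder A] [StarOrderedRing A]
    (p q r t l u v w : A)
    (hp : star p = p) (hp2 : p * p = p)
    (hq : star q = q) (hq2 : q * q = q)
    (hr : star r = r) (hr2 : r * r = r) (hrc : ∀ a : A, r * a = a * r)
    (ht : star t = t) (ht2 : t * t = t) (htc : ∀ a : A, t * a = a * t)
    (hl : star l = l) (hl2 : l * l = l) (hlc : ∀ a : A, l * a = a * l)
    (hrt : r * t = 0) (hrl : r * l = 0) (htl : t * l = 0)
    (hsum : r + t + l = 1)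
    (hu : u * star u * u = u) (hv : v * star v * v = v) (hw : w * star w * w = w)
    (huu : u * star u = r * p) (huu' : star u * u ≤ r * q)
    (hvv : v * star v = t * p) (hvv' : star v * v = t * q)
    (hww : w * star w ≤ l * p) (hww' : star w * w = l * q)
    (e : A) (he : e = u + v + w) :
    ∀ x : A, p * x * q = x →
      max ‖(t + l) * x * star e‖ ‖star e * (r * x)‖ = ‖x‖ := by
  intro x hx
  have hpx : p * x = x := by rw [← hx, ← mul_assoc, ← mul_assoc, hp2]
  have hxq : x * q = x := by rw [← hx, mul_assoc, hq2]
  have hru : r * u = u := by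
    rw [← hu, huu, ← mul_assoc, ← mul_assoc, hr2]
  have htv : t * v = v := by
    rw [← hv, hvv, ← mul_assoc, ← mul_assoc, ht2]
  have hlw : l * w = w := by
    rw [hlc, ← hw, mul_assoc w, hww', mul_assoc, mul_assoc, ← hlc q, ← mul_assoc l l, hl2]
  have hrv : r * v = 0 := by rw [← htv, ← mul_assoc, hrt, zero_mul]
  have hrw : r * w = 0 := by rw [← hlw, ← mul_assoc, hrl, zero_mul]
  have hre : r * e = u := by rw [he, mul_add, mul_add, hru, hrv, hrw, add_zero, add_zero]
  have hzr : (t + l) * r = 0 := by rw [add_mul, ← hrc, ← hrc, hrt, hrl, add_zero]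
  have hzc (a : A) : (t + l) * a = a * (t + l) := by rw [add_mul, mul_add, htc, hlc]
  have hz : t + l = 1 - r := by rw [← hsum]; abel
  have hze : (t + l) * e = v + w := by
    rw [hz, sub_mul, one_mul, hre, he]; abel
  have hvw : star v * w = 0 := by
    rw [← hlw, ← htv, star_mul, ht, mul_assoc, ← mul_assoc t, htl, zero_mul, mul_zero]
  have hwv : star w * v = 0 := by simpa using congrArg star hvw
  have huv : star u * v = 0 := by
    rw [← hru, star_mul, hr, mul_assoc, hrv, mul_zero]
  have huw : star u * w = 0 := by
    rw [← hru, star_mul, hr, mul_assoc, hrw, mul_zero]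
  have hzee : (t + l) * (star e * e) = (t + l) * q := by
    rw [hzc, mul_assoc, ← hzc, hze, he]
    simp [add_mul, mul_add, huv, huw, hvw, hwv, hvv', hww']
  have hree : r * (e * star e) = r * p := by
    have hur : u * r = u := by rw [← hrc, hru]
    have hue : r * star e = star u := by rw [← hre, star_mul, hr, hrc]
    rw [← mul_assoc, hre, ← hur, mul_assoc, hue, huu]
  have h1 : ‖(t + l) * x * star e‖ = ‖(t + l) * x‖ := by
    refine norm_mul_star_of_mul_star_mul_eq ?_
    rw [hzc, mul_assoc, hzee, ← mul_assoc, ← hzc, mul_assoc, hxq]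
  have h2 : ‖star e * (r * x)‖ = ‖r * x‖ := by
    refine norm_star_mul_of_mul_star_mul_eq ?_
    rw [← mul_assoc, ← hrc, hree, mul_assoc, hpx]
  rw [h1, h2, ← norm_add_eq_max_of_star_mul_eq_zero, ← add_mul, hz, sub_add_cancel, one_mul]
  · rw [star_mul, star_add, ht, hl, mul_assoc, ← mul_assoc (t + l), hzr, zero_mul, mul_zero]
  · rw [star_mul, hr, ← hrc, hzc, mul_assoc, ← mul_assoc (t + l), hzr, zero_mul, mul_zero]
end

section
/- Let A be a unital C*-algebra, let p, q ∈ A be projections, let r, t, l ∈ A be pairwise orthogonal central projections with r + t + l = 1, and let u, v, w ∈ A be partial isometries with u u* = r p, u* u ≤ r q, v v* = t p, v* v = t q, w w* ≤ l p, and w* w = l q. Set e := u + v + w and T := {t x e* : x ∈ A, p x q = x}. Then T is a two-sided ideal of the corner algebra p A p: for every a ∈ A and every x ∈ A with p x q = x, both (p a p)(t x e*) and (t x e*)(p a p) belong to T. -/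
/-- **Two-sided-ideal part of the ideal decomposition.**
With notation as in the paper's main construction, set `e := u + v + w` and
`T := {t x e* : x ∈ A, p x q = x}`.  Then `T` is a two-sided ideal of the
corner algebra `p A p`: for every `a ∈ A` and every `x ∈ A` with `p x q = x`,
both `(p a p)(t x e*)` and `(t x e*)(p a p)` belong to `T`. -/
theorem ideal_decomposition_two_sided_ideal
    {A : Type*} [CStarAlgebra A] [PartialOrder A] [StarOrderedRing A]
    (p q r t l u v w : A)
    (hp : star p = p) (hp2 : p * p = p)
    (hq : star q = q) (hq2 : q * q = q)
    (hr : star r = r) (hr2 : r * r = r) (hrc : ∀ a : A, r * a = a * r)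
    (ht : star t = t) (ht2 : t * t = t) (htc : ∀ a : A, t * a = a * t)
    (hl : star l = l) (hl2 : l * l = l) (hlc : ∀ a : A, l * a = a * l)
    (hrt : r * t = 0) (hrl : r * l = 0) (htl : t * l = 0)
    (hsum : r + t + l = 1)
    (hu : u * star u * u = u) (hv : v * star v * v = v) (hw : w * star w * w = w)
    (huu : u * star u = r * p) (huu' : star u * u ≤ r * q)
    (hvv : v * star v = t * p) (hvv' : star v * v = t * q)
    (hww : w * star w ≤ l * p) (hww' : star w * w = l * q)
    (e : A) (he : e = u + v + w)
    (T : Set A) (hT : T = {y : A | ∃ x : A, p * x * q = x ∧ y = t * x * star e}) :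
    ∀ a x : A, p * x * q = x →
      (p * a * p) * (t * x * star e) ∈ T ∧ (t * x * star e) * (p * a * p) ∈ T := by
  have htr : t * r = 0 := by rw [htc, hrt]
  have htu : t * u = 0 := by
    rw [← hu, huu, ← mul_assoc, ← mul_assoc, htr, zero_mul, zero_mul]
  have htw : t * w = 0 := by
    rw [← hw, mul_assoc, hww', htc, mul_assoc, mul_assoc, ← htc q, ← mul_assoc l, hlc t, htl,
      zero_mul, mul_zero]
  have htv : t * v = v := by
    rw [← hv, hvv, ← mul_assoc, ← mul_assoc, ht2]
  have hvq : v * q = v := by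
    rw [← hv, mul_assoc v, hvv', mul_assoc, mul_assoc, hq2]
  have hte : t * star e = star v := by
    have h : e * t = v := by rw [← htc, he, mul_add, mul_add, htu, htv, htw, zero_add, add_zero]
    rw [← h, star_mul, ht]
  have hxe (x : A) : t * x * star e = x * star v := by rw [htc, mul_assoc, hte]
  have htsv : star v * t = star v := by rw [← htc, ← ht, ← star_mul, ← htc, htv]
  subst hT
  intro a x hx
  have hpx : p * x = x := by
    rw [← hx, ← mul_assoc, ← mul_assoc, hp2]
  have hxq : x * q = x := by
    rw [← hx, mul_assoc, hq2]
  refine ⟨⟨p * a * p * x, ?_, ?_⟩, ⟨x * star v * (p * a * p) * v, ?_, ?_⟩⟩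
  · rw [mul_assoc, mul_assoc (p * a * p), hxq, mul_assoc p a p, ← mul_assoc, ← mul_assoc p p, hp2]
  · rw [hxe, hxe, mul_assoc (p * a * p)]
  · rw [mul_assoc, mul_assoc _ v q, hvq]
    simp only [← mul_assoc, hpx]
  · have htM : t * (x * star v) = x * star v := by rw [htc, mul_assoc, htsv]
    rw [hxe, hxe, mul_assoc _ v, hvv, ← mul_assoc _ t p, ← htc (x * star v * (p * a * p)),
      ← mul_assoc t, htM, mul_assoc _ (p * a * p) p, mul_assoc (p * a), hp2]
end

section
/- Let A be a unital C*-algebra, let p, q ∈ A be projections, let r, t, l ∈ A be pairwise orthogonal central projections with r + t + l = 1, and let u, v, w ∈ A be partial isometries with u u* = r p, u* u ≤ r q, v v* = t p, v* v = t q, w w* ≤ l p, and w* w = l q. Set e := u + v + w. Then for every n and every n × n matrix X over A all of whose entries x satisfy p x q = x, one has max(‖X₁‖, ‖X₂‖) = ‖X‖, where X₁ is the matrix obtained by applying x ↦ (t + l) x e* entrywise, X₂ is obtained by applying x ↦ e* (r x) entrywise, and matrices over A carry the unique C*-norm on Mₙ(A). -/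
section CStarRing

variable {E : Type*} [NormedRing E] [StarRing E] [CStarRing E]

/-- In a (not necessarily complete) C⋆-ring, the norm of a sum of two orthogonal self-adjoint
elements is at most the maximum of their norms. -/
theorem IsSelfAdjoint.norm_add_le_max {a b : E} (ha : IsSelfAdjoint a) (hb : IsSelfAdjoint b)
    (hab : a * b = 0) : ‖a + b‖ ≤ max ‖a‖ ‖b‖ := by
  have hba : b * a = 0 := by
    simpa [ha.star_eq, hb.star_eq] using congrArg star hab
  have hpow (k : ℕ) : (a + b) ^ (k + 1) = a ^ (k + 1) + b ^ (k + 1) := by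
    induction k with
    | zero => simp
    | succ k ih =>
      have h₁ : a ^ (k + 1) * b = 0 := by rw [pow_succ, mul_assoc, hab, mul_zero]
      have h₂ : b ^ (k + 1) * a = 0 := by rw [pow_succ, mul_assoc, hba, mul_zero]
      rw [pow_succ, ih, add_mul, mul_add, mul_add, h₁, h₂, ← pow_succ, ← pow_succ, add_zero,
        zero_add]
  set M := max ‖a‖ ‖b‖ with hM
  have hM0 : 0 ≤ M := (norm_nonneg a).trans (le_max_left _ _)
  have hbound (k : ℕ) : ‖a + b‖ ^ 2 ^ k ≤ 2 * M ^ 2 ^ k := by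
    obtain ⟨j, hj⟩ := Nat.exists_eq_succ_of_ne_zero (pow_ne_zero k two_ne_zero : 2 ^ k ≠ 0)
    calc ‖a + b‖ ^ 2 ^ k = ‖(a + b) ^ 2 ^ k‖ := ((ha.add hb).norm_pow_two_pow k).symm
      _ = ‖a ^ 2 ^ k + b ^ 2 ^ k‖ := by rw [hj, Nat.succ_eq_add_one, hpow]
      _ ≤ ‖a ^ 2 ^ k‖ + ‖b ^ 2 ^ k‖ := norm_add_le _ _
      _ = ‖a‖ ^ 2 ^ k + ‖b‖ ^ 2 ^ k := by rw [ha.norm_pow_two_pow, hb.norm_pow_two_pow]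
      _ ≤ M ^ 2 ^ k + M ^ 2 ^ k := by
        gcongr
        · exact le_max_left _ _
        · exact le_max_right _ _
      _ = 2 * M ^ 2 ^ k := by ring
  by_contra! hlt
  rcases hM0.eq_or_lt with h0 | hpos
  · have := hbound 0
    rw [← h0] at this hlt
    simp only [pow_zero, pow_one, mul_zero] at this
    exact absurd hlt this.not_gt
  · have h1 : 1 < ‖a + b‖ / M := (one_lt_div hpos).2 hlt
    obtain ⟨k, hk⟩ := pow_unbounded_of_one_lt 2 h1
    have hle : (‖a + b‖ / M) ^ 2 ^ k ≤ 2 := by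
      rw [div_pow, div_le_iff₀ (pow_pos hpos _)]
      exact hbound k
    have hmono : (‖a + b‖ / M) ^ k ≤ (‖a + b‖ / M) ^ 2 ^ k :=
      pow_le_pow_right₀ h1.le Nat.lt_two_pow_self.le
    linarith

/-- Multiplication by a self-adjoint idempotent does not increase the norm. -/
theorem IsStarProjection.norm_mul_le {z : E} (hz : IsStarProjection z) (x : E) :
    ‖z * x‖ ≤ ‖x‖ := by
  have h : ‖z‖ * ‖z‖ = ‖z‖ := by
    rw [← CStarRing.norm_star_mul_self, hz.isSelfAdjoint.star_eq, hz.isIdempotentElem.eq]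
  have hz1 : ‖z‖ ≤ 1 := by nlinarith [norm_nonneg z]
  exact (_root_.norm_mul_le z x).trans (mul_le_of_le_one_left (norm_nonneg x) hz1)

/-- A central projection splits the norm of a C⋆-ring as a maximum. -/
theorem IsStarProjection.max_norm_mul {z r : E} (hz : IsStarProjection z)
    (hr : IsStarProjection r) (hzc : ∀ a, Commute z a) (hrc : ∀ a, Commute r a)
    (hzr : z + r = 1) (x : E) : max ‖z * x‖ ‖r * x‖ = ‖x‖ := by
  refine le_antisymm (max_le (hz.norm_mul_le x) (hr.norm_mul_le x)) ?_
  have hzr0 : z * r = 0 := by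
    rw [← sub_eq_iff_eq_add'.2 hzr.symm, mul_sub, mul_one, hz.isIdempotentElem.eq, sub_self]
  have key {c : E} (hc : IsStarProjection c) (hcc : ∀ a, Commute c a) :
      star (c * x) * (c * x) = c * (star x * x) := by
    rw [star_mul, hc.isSelfAdjoint.star_eq, mul_assoc, ← mul_assoc c c,
      hc.isIdempotentElem.eq, ← mul_assoc, ← mul_assoc, (hcc (star x)).eq]
  have hsum : star x * x = star (z * x) * (z * x) + star (r * x) * (r * x) := by
    rw [key hz hzc, key hr hrc, ← add_mul, hzr, one_mul]
  have horth : star (z * x) * (z * x) * (star (r * x) * (r * x)) = 0 := by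
    rw [key hz hzc, key hr hrc, mul_assoc z, ← mul_assoc (star x * x), ← (hrc (star x * x)).eq,
      mul_assoc r, ← mul_assoc, hzr0, zero_mul]
  have hle := (IsSelfAdjoint.star_mul_self (z * x)).norm_add_le_max
    (IsSelfAdjoint.star_mul_self (r * x)) horth
  rw [← hsum] at hle
  simp only [CStarRing.norm_star_mul_self] at hle
  rcases le_max_iff.1 hle with h | h
  · exact le_max_of_le_left (abs_le_of_sq_le_sq' (by nlinarith) (norm_nonneg _)).2
  · exact le_max_of_le_right (abs_le_of_sq_le_sq' (by nlinarith) (norm_nonneg _)).2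

/-- If `e` is, up to the central projections `z` and `r = 1 - z`, a partial isometry with initial
projection `q` over `z` and final projection `p` over `r`, then `x ↦ (z x e⋆, e⋆ r x)` is isometric
on `p E q`. -/
theorem CStarRing.max_norm_mul_star_eq {z r p q e : E} (hz : IsStarProjection z)
    (hr : IsStarProjection r) (hzc : ∀ a, Commute z a) (hrc : ∀ a, Commute r a)
    (hzr : z + r = 1) (hze : z * (star e * e) = z * q) (hre : r * (e * star e) = r * p)
    {x : E} (hpx : p * x = x) (hxq : x * q = x) :
    max ‖z * x * star e‖ ‖star e * (r * x)‖ = ‖x‖ := by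
  rw [← hz.max_norm_mul hr hzc hrc hzr x]
  have h₁ : ‖z * x * star e‖ = ‖z * x‖ := by
    rw [← mul_self_inj_of_nonneg (norm_nonneg _) (norm_nonneg _), ← CStarRing.norm_self_mul_star,
      ← CStarRing.norm_self_mul_star]
    congr 1
    calc z * x * star e * star (z * x * star e)
        = (z * x) * (star e * e) * star (z * x) := by
          simp only [star_mul, star_star, mul_assoc]
      _ = x * (z * (star e * e)) * star (z * x) := by rw [(hzc x).eq, mul_assoc x]
      _ = z * (x * q) * star (z * x) := by
          rw [hze, ← mul_assoc x, ← (hzc x).eq, mul_assoc z]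
      _ = z * x * star (z * x) := by rw [hxq]
  have h₂ : ‖star e * (r * x)‖ = ‖r * x‖ := by
    rw [← mul_self_inj_of_nonneg (norm_nonneg _) (norm_nonneg _), ← CStarRing.norm_star_mul_self,
      ← CStarRing.norm_star_mul_self]
    congr 1
    calc star (star e * (r * x)) * (star e * (r * x))
        = star (r * x) * ((e * star e) * r * x) := by
          simp only [star_mul, star_star, mul_assoc]
      _ = star (r * x) * (r * (p * x)) := by rw [← (hrc (e * star e)).eq, hre, mul_assoc r]
      _ = star (r * x) * (r * x) := by rw [hpx]
  rw [h₁, h₂]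

end CStarRing

theorem Matrix.star_scalar {A n : Type*} [Semiring A] [StarRing A] [Fintype n] [DecidableEq n]
    (a : A) : star (Matrix.scalar n a) = Matrix.scalar n (star a) := by
  rw [Matrix.star_eq_conjTranspose, Matrix.scalar_apply, Matrix.diagonal_conjTranspose]
  rfl

theorem IsStarProjection.matrix_scalar {A n : Type*} [Semiring A] [StarRing A] [Fintype n]
    [DecidableEq n] {a : A} (ha : IsStarProjection a) :
    IsStarProjection (Matrix.scalar n a) where
  isIdempotentElem := by rw [IsIdempotentElem, ← map_mul, ha.isIdempotentElem.eq]
  isSelfAdjoint := by rw [IsSelfAdjoint, Matrix.star_scalar, ha.isSelfAdjoint.star_eq]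


/-- **Complete isometry (matrix level) of the ideal-decomposition map.**
With notation as in the paper's main construction, set `e := u + v + w`.  Then
for every `n` and every `n × n` matrix `X` over `A` all of whose entries `x`
satisfy `p x q = x`, one has `max (‖X₁‖, ‖X₂‖) = ‖X‖`, where `X₁` is obtained
by applying `x ↦ (t + l) x e*` entrywise, `X₂` by applying `x ↦ e* (r x)`
entrywise, and `Mₙ(A)` carries the unique C*-norm.  Since this Mathlib version
has no canonical C*-norm on `Matrix (Fin n) (Fin n) A`, the unique C*-norm is
formalized by quantifying over an arbitrary C*-norm `ν` on the *-algebra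
`Matrix (Fin n) (Fin n) A` (a subadditive, absolutely homogeneous,
submultiplicative, definite function satisfying the C*-identity). -/
theorem max_norm_ideal_decomposition_matrix
    {A : Type*} [CStarAlgebra A] [PartialOrder A] [StarOrderedRing A]
    (p q r t l u v w : A)
    (hp : star p = p) (hp2 : p * p = p)
    (hq : star q = q) (hq2 : q * q = q)
    (hr : star r = r) (hr2 : r * r = r) (hrc : ∀ a : A, r * a = a * r)
    (ht : star t = t) (ht2 : t * t = t) (htc : ∀ a : A, t * a = a * t)
    (hl : star l = l) (hl2 : l * l = l) (hlc : ∀ a : A, l * a = a * l)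
    (hrt : r * t = 0) (hrl : r * l = 0) (htl : t * l = 0)
    (hsum : r + t + l = 1)
    (hu : u * star u * u = u) (hv : v * star v * v = v) (hw : w * star w * w = w)
    (huu : u * star u = r * p) (huu' : star u * u ≤ r * q)
    (hvv : v * star v = t * p) (hvv' : star v * v = t * q)
    (hww : w * star w ≤ l * p) (hww' : star w * w = l * q)
    (e : A) (he : e = u + v + w)
    (n : ℕ) (ν : Matrix (Fin n) (Fin n) A → ℝ)
    (hν0 : ∀ X : Matrix (Fin n) (Fin n) A, ν X = 0 ↔ X = 0)
    (hνadd : ∀ X Y : Matrix (Fin n) (Fin n) A, ν (X + Y) ≤ ν X + ν Y)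
    (hνsmul : ∀ (c : ℂ) (X : Matrix (Fin n) (Fin n) A), ν (c • X) = ‖c‖ * ν X)
    (hνmul : ∀ X Y : Matrix (Fin n) (Fin n) A, ν (X * Y) ≤ ν X * ν Y)
    (hνstar : ∀ X : Matrix (Fin n) (Fin n) A, ν (star X * X) = ν X * ν X) :
    ∀ X : Matrix (Fin n) (Fin n) A, (∀ i j, p * X i j * q = X i j) →
      max (ν (X.map fun x => (t + l) * x * star e))
          (ν (X.map fun x => star e * (r * x))) = ν X := by

  intro X hX
  have hνneg (Y : Matrix (Fin n) (Fin n) A) : ν (-Y) = ν Y := by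
    simpa using hνsmul (-1) Y
  let N : RingNorm (Matrix (Fin n) (Fin n) A) :=
    { toFun := ν
      map_zero' := (hν0 0).2 rfl
      add_le' := hνadd
      neg' := hνneg
      mul_le' := hνmul
      eq_zero_of_map_eq_zero' := fun Y => (hν0 Y).1 }
  let _ : NormedRing (Matrix (Fin n) (Fin n) A) := N.toNormedRing
  have _ : CStarRing (Matrix (Fin n) (Fin n) A) := ⟨fun Y => (hνstar Y).ge⟩
  have hru : r * u = u := by
    rw [← hu, huu, ← mul_assoc, ← mul_assoc, hr2]
  have htv : t * v = v := by
    rw [← hv, hvv, ← mul_assoc, ← mul_assoc, ht2]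
  have hlw : l * w = w := by
    have h : w = w * (l * q) := by rw [← hww', ← mul_assoc, hw]
    rw [h, ← mul_assoc w, ← hlc w, ← mul_assoc, ← mul_assoc, hl2]
  have htr : t * r = 0 := by rw [htc, hrt]
  have hlr : l * r = 0 := by rw [hlc, hrl]
  have hlt : l * t = 0 := by rw [hlc, htl]
  have hre : r * e = u := by
    rw [he, mul_add, mul_add, hru, ← htv, ← hlw, ← mul_assoc, ← mul_assoc, hrt, hrl]
    simp
  have hte : t * e = v := by
    rw [he, mul_add, mul_add, htv, ← hru, ← hlw, ← mul_assoc, ← mul_assoc, htr, htl]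
    simp
  have hle : l * e = w := by
    rw [he, mul_add, mul_add, hlw, ← hru, ← htv, ← mul_assoc, ← mul_assoc, hlr, hlt]
    simp
  have compress {c : A} (hc : star c = c) (hc2 : c * c = c) (hcc : ∀ a, c * a = a * c) :
      c * (star e * e) = star (c * e) * (c * e) ∧ c * (e * star e) = c * e * star (c * e) := by
    constructor
    · rw [star_mul, hc, mul_assoc, ← mul_assoc c c, hc2, ← mul_assoc, hcc (star e), mul_assoc]
    · rw [star_mul, hc, ← mul_assoc (c * e), ← hcc (c * e * star e), ← mul_assoc c (c * e),
        ← mul_assoc c c, hc2, mul_assoc]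
  have hze : (t + l) * (star e * e) = (t + l) * q := by
    rw [add_mul, (compress ht ht2 htc).1, (compress hl hl2 hlc).1, hte, hle, hvv', hww', ← add_mul]
  have hre' : r * (e * star e) = r * p := by rw [(compress hr hr2 hrc).2, hre, huu]
  have hr' : IsStarProjection r := ⟨hr2, hr⟩
  have htl' : IsStarProjection (t + l) :=
    ⟨by rw [IsIdempotentElem, add_mul, mul_add, mul_add, ht2, hl2, htl, hlt, add_zero, zero_add],
      by rw [IsSelfAdjoint, star_add, ht, hl]⟩
  have hpx (i j) : p * X i j = X i j := by rw [← hX i j, ← mul_assoc, ← mul_assoc, hp2]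
  have hxq (i j) : X i j * q = X i j := by rw [← hX i j, mul_assoc, hq2]
  have main := CStarRing.max_norm_mul_star_eq (x := X) (p := Matrix.scalar (Fin n) p)
    (q := Matrix.scalar (Fin n) q) (e := Matrix.scalar (Fin n) e)
    (htl'.matrix_scalar (n := Fin n)) (hr'.matrix_scalar (n := Fin n))
    (Matrix.scalar_commute _ fun a => by rw [commute_iff_eq, add_mul, mul_add, htc, hlc])
    (Matrix.scalar_commute _ hrc)
    (by rw [← map_add, add_comm, ← add_assoc, hsum, map_one])
    (by rw [Matrix.star_scalar, ← map_mul, ← map_mul, ← map_mul, hze])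
    (by rw [Matrix.star_scalar, ← map_mul, ← map_mul, ← map_mul, hre'])
    (by ext i j; simp [Matrix.scalar_apply, hpx])
    (by ext i j; simp [Matrix.scalar_apply, hxq])
  have h₁ : (X.map fun x => (t + l) * x * star e) =
      Matrix.scalar (Fin n) (t + l) * X * star (Matrix.scalar (Fin n) e) := by
    ext i j
    rw [Matrix.star_scalar]
    simp [-map_add, Matrix.scalar_apply]
  have h₂ : (X.map fun x => star e * (r * x)) =
      star (Matrix.scalar (Fin n) e) * (Matrix.scalar (Fin n) r * X) := by
    ext i j
    rw [Matrix.star_scalar]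
    simp [Matrix.scalar_apply]
  rw [h₁, h₂]
  exact main
end
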